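/- arXiv:1005.3233 — 3 statements merged into one kernel-verified Lean document; each statement's English description precedes it below -/
import Mathlib

section
/- For every positive integer N, the sum over r from 1 to N and over M from 1 to min(r, N−r+1) of p(r, M) equals p(N+1) − 1. Equivalently, the number ν(N) of inequivalent Bernoulli sequences of length N containing at least one success (where two sequences are equivalent if and only if they have the same multiset of success-run lengths) equals p(N+1) − 1. -/
/-- `p n`: the number of partitions of `n` into unordered positive integer parts
(with `p 0 = 1`). -/
def partCount (n : ℕ) : ℕ := Fintype.card (Nat.Partition n)

/-- `p(n, k)`: the number of partitions of `n` into exactly `k` positive parts. -/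
def partCountEq (n k : ℕ) : ℕ :=
  (Finset.univ.filter fun π : Nat.Partition n => Multiset.card π.parts = k).card

/-- The multiset of lengths of the success runs (maximal blocks of consecutive `true`s)
of a binary sequence `ξ`, where `true` denotes success. Two sequences are equivalent
iff they have the same `runType`, so the equivalence classes correspond to run-types. -/
def runType {N : ℕ} (ξ : Fin N → Bool) : Multiset ℕ :=
  ↑((((List.ofFn ξ).splitOn false).map List.length).filter (· ≠ 0))

namespace Nat.Partition

/-- The multiset obtained from a partition by subtracting `1` from every part and discarding
the parts that become `0`. -/
def predParts {n : ℕ} (π : Nat.Partition n) : Multiset ℕ :=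
  (π.parts.filter (· ≠ 1)).map (· - 1)

theorem map_succ_predParts_add_replicate {n : ℕ} (π : Nat.Partition n) :
    π.predParts.map (· + 1) + Multiset.replicate (π.parts.count 1) 1 = π.parts := by
  have h : π.predParts.map (· + 1) = π.parts.filter (· ≠ 1) := by
    rw [predParts, Multiset.map_map]
    refine (Multiset.map_congr rfl fun x hx => ?_).trans (Multiset.map_id' _)
    exact Nat.sub_add_cancel (π.parts_pos (Multiset.mem_of_mem_filter hx))
  rw [h, ← Multiset.filter_eq', add_comm]
  exact Multiset.filter_add_not _ _

theorem sum_add_card_predParts_add_count {n : ℕ} (π : Nat.Partition n) :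
    π.predParts.sum + π.predParts.card + π.parts.count 1 = n := by
  have h := congrArg Multiset.sum π.map_succ_predParts_add_replicate
  simpa [Multiset.sum_map_add, π.parts_sum] using h

theorem predParts_injective (n : ℕ) :
    Function.Injective (predParts : Nat.Partition n → Multiset ℕ) := by
  intro π σ h
  have hc : π.parts.count 1 = σ.parts.count 1 := by
    have h₁ := π.sum_add_card_predParts_add_count
    have h₂ := σ.sum_add_card_predParts_add_count
    rw [h] at h₁
    omega
  ext1
  rw [← π.map_succ_predParts_add_replicate, ← σ.map_succ_predParts_add_replicate, h, hc]

theorem exists_predParts_eq_iff {n : ℕ} {m : Multiset ℕ} :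
    (∃ π : Nat.Partition n, π.predParts = m) ↔ 0 ∉ m ∧ m.sum + m.card ≤ n := by
  constructor
  · rintro ⟨π, rfl⟩
    refine ⟨fun h => ?_, by have := π.sum_add_card_predParts_add_count; omega⟩
    simp only [predParts, Multiset.mem_map, Multiset.mem_filter] at h
    obtain ⟨a, ⟨ha, ha1⟩, ha0⟩ := h
    have := π.parts_pos ha
    omega
  · rintro ⟨h0, hm⟩
    refine ⟨⟨m.map (· + 1) + Multiset.replicate (n - (m.sum + m.card)) 1, ?_, ?_⟩, ?_⟩
    · intro i hi
      rcases Multiset.mem_add.1 hi with hi | hi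
      · obtain ⟨a, -, rfl⟩ := Multiset.mem_map.1 hi
        exact a.succ_pos
      · rw [Multiset.eq_of_mem_replicate hi]
        exact one_pos
    · simp only [Multiset.sum_add, Multiset.sum_map_add, Multiset.map_id', Multiset.map_const',
        Multiset.sum_replicate, smul_eq_mul, mul_one]
      omega
    · have h1 : (m.map (· + 1)).filter (· ≠ 1) = m.map (· + 1) := by
        refine Multiset.filter_eq_self.2 fun a ha => ?_
        obtain ⟨b, hb, rfl⟩ := Multiset.mem_map.1 ha
        have : b ≠ 0 := fun h => h0 (h ▸ hb)
        omega
      have h2 : (Multiset.replicate (n - (m.sum + m.card)) 1).filter (· ≠ 1) = 0 :=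
        Multiset.filter_eq_nil.2 fun a ha => by simp [Multiset.eq_of_mem_replicate ha]
      simp only [predParts, Multiset.filter_add, h1, h2, add_zero, Multiset.map_map]
      exact Multiset.map_id' m

end Nat.Partition

/-- The nonempty multisets of positive integers that occur as run-types of sequences of
length `N`. -/
def runTypes (N : ℕ) : Finset (Multiset ℕ) :=
  (Finset.univ.image (Nat.Partition.predParts (n := N + 1))).erase 0

theorem mem_runTypes {N : ℕ} {m : Multiset ℕ} :
    m ∈ runTypes N ↔ m ≠ 0 ∧ 0 ∉ m ∧ m.sum + m.card ≤ N + 1 := by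
  simp [runTypes, Nat.Partition.exists_predParts_eq_iff]

theorem card_runTypes (N : ℕ) : (runTypes N).card = partCount (N + 1) - 1 := by
  rw [runTypes, Finset.card_erase_of_mem,
    Finset.card_image_of_injective _ (Nat.Partition.predParts_injective _), Finset.card_univ,
    partCount]
  simp [Nat.Partition.exists_predParts_eq_iff]

theorem partCountEq_eq_card_filter_runTypes {N r M : ℕ} (hr : 1 ≤ r) (h : r + M ≤ N + 1) :
    partCountEq r M = {m ∈ runTypes N | m.sum = r ∧ m.card = M}.card := by
  rw [partCountEq]
  refine Finset.card_bij (fun π _ => π.parts) ?_ (fun π _ σ _ => Nat.Partition.ext) ?_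
  · intro π hπ
    have hc : π.parts.card = M := by simpa using hπ
    rw [Finset.mem_filter, mem_runTypes, π.parts_sum, hc]
    refine ⟨⟨fun h0 => ?_, fun h0 => (π.parts_pos h0).false, h⟩, rfl, rfl⟩
    have := π.parts_sum
    simp only [h0, Multiset.sum_zero] at this
    omega
  · intro m hm
    rw [Finset.mem_filter, mem_runTypes] at hm
    obtain ⟨⟨-, h0, -⟩, hs, hc⟩ := hm
    exact ⟨⟨m, fun hi => Nat.pos_of_ne_zero fun h => h0 (h ▸ hi), hs⟩, by simpa using hc, rfl⟩

theorem Multiset.card_le_sum_of_zero_notMem {m : Multiset ℕ} (h0 : 0 ∉ m) : m.card ≤ m.sum := by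
  simpa using Multiset.card_nsmul_le_sum
    (fun x hx => Nat.one_le_iff_ne_zero.2 fun h => h0 (h ▸ hx) : ∀ x ∈ m, 1 ≤ x)

theorem sum_partCountEq_eq_card_runTypes (N : ℕ) :
    ∑ r ∈ Finset.Icc 1 N, ∑ M ∈ Finset.Icc 1 (min r (N - r + 1)), partCountEq r M
      = (runTypes N).card := by
  have bounds {m : Multiset ℕ} (hm : m ∈ runTypes N) :
      1 ≤ m.card ∧ m.card ≤ m.sum ∧ m.sum + m.card ≤ N + 1 := by
    obtain ⟨hne, h0, hle⟩ := mem_runTypes.1 hm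
    exact ⟨Multiset.card_pos.2 hne, Multiset.card_le_sum_of_zero_notMem h0, hle⟩
  rw [Finset.card_eq_sum_card_fiberwise (f := Multiset.sum) (t := Finset.Icc 1 N)]
  · refine Finset.sum_congr rfl fun r hr => ?_
    rw [Finset.mem_Icc] at hr
    rw [Finset.card_eq_sum_card_fiberwise (f := Multiset.card)
      (t := Finset.Icc 1 (min r (N - r + 1)))]
    · refine Finset.sum_congr rfl fun M hM => ?_
      rw [Finset.mem_Icc] at hM
      rw [Finset.filter_filter]
      exact partCountEq_eq_card_filter_runTypes hr.1 (by omega)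
    · intro m hm
      rw [Finset.mem_coe, Finset.mem_filter] at hm
      have := bounds hm.1
      simp only [Finset.coe_Icc, Set.mem_Icc]
      omega
  · intro m hm
    rw [Finset.mem_coe] at hm
    have := bounds hm
    simp only [Finset.coe_Icc, Set.mem_Icc]
    omega

namespace List

theorem length_intercalate_singleton_add_one {α : Type*} (a : α) {ls : List (List α)}
    (h : ls ≠ []) :
    ([a].intercalate ls).length + 1 = (ls.map length).sum + ls.length := by
  induction ls with
  | nil => exact absurd rfl h
  | cons l ls ih =>
    cases ls with
    | nil => simp
    | cons l' ls =>
      have := ih (cons_ne_nil _ _)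
      simp only [intercalate_cons_cons, length_append, map_cons, sum_cons, length_cons,
        length_nil] at this ⊢
      omega

theorem mem_intercalate_singleton_of_ne {α : Type*} {a b : α} (hab : b ≠ a)
    {ls : List (List α)} : b ∈ [a].intercalate ls ↔ ∃ l ∈ ls, b ∈ l := by
  induction ls with
  | nil => simp
  | cons l ls ih =>
    cases ls with
    | nil => simp
    | cons l' ls => simp_all

end List

theorem runType_mem_runTypes {N : ℕ} {ξ : Fin N → Bool} (hξ : ∃ i, ξ i = true) :
    runType ξ ∈ runTypes N := by
  set ls := (List.ofFn ξ).splitOn false with hls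
  have hint : [false].intercalate ls = List.ofFn ξ := List.intercalate_splitOn false
  have hlen := List.length_intercalate_singleton_add_one false
    (List.splitOn_ne_nil false (List.ofFn ξ))
  rw [← hls, hint, List.length_ofFn] at hlen
  rw [mem_runTypes, runType, ← hls]
  refine ⟨?_, by simp, ?_⟩
  · obtain ⟨i, hi⟩ := hξ
    have hmem : true ∈ [false].intercalate ls := hint ▸ List.mem_ofFn.2 ⟨i, hi⟩
    obtain ⟨l, hl, htl⟩ := (List.mem_intercalate_singleton_of_ne (by decide)).1 hmem
    have : l.length ∈ (ls.map List.length).filter (· ≠ 0) := by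
      simpa using ⟨⟨l, hl, rfl⟩, List.ne_nil_of_mem htl⟩
    exact fun h => List.ne_nil_of_mem this (Multiset.coe_eq_zero _ |>.1 h)
  · rw [Multiset.sum_coe, Multiset.coe_card, hlen]
    refine add_le_add (List.filter_sublist.sum_le_sum fun _ _ => Nat.zero_le _) ?_
    simpa using List.length_filter_le (· ≠ 0) (ls.map List.length)

theorem exists_runType_eq {N : ℕ} {m : Multiset ℕ} (hm : m ∈ runTypes N) :
    ∃ ξ : Fin N → Bool, (∃ i, ξ i = true) ∧ runType ξ = m := by
  obtain ⟨hne, h0, hle⟩ := mem_runTypes.1 hm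
  obtain ⟨L, rfl⟩ := Quotient.exists_rep m
  change (L : Multiset ℕ) ≠ 0 at hne
  change 0 ∉ (L : Multiset ℕ) at h0
  change (L : Multiset ℕ).sum + (L : Multiset ℕ).card ≤ N + 1 at hle
  simp only [Multiset.sum_coe, Multiset.coe_card, Multiset.mem_coe, ne_eq,
    Multiset.coe_eq_zero] at hne h0 hle
  set ls : List (List Bool) := L.map (List.replicate · true) ++
    List.replicate (N + 1 - (L.sum + L.length)) [] with hls
  have hls_ne : ls ≠ [] := by simp [hls, hne]
  have hmap : ls.map List.length = L ++ List.replicate (N + 1 - (L.sum + L.length)) 0 := by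
    simp [hls, Function.comp_def]
  have hlen : ([false].intercalate ls).length = N := by
    have := List.length_intercalate_singleton_add_one false hls_ne
    rw [hmap] at this
    rw [hls, List.length_append, List.length_map, List.length_replicate, ← hls] at this
    simp only [List.sum_append, List.sum_replicate, smul_zero, add_zero] at this
    omega
  have hsplit : ([false].intercalate ls).splitOn false = ls := by
    refine List.splitOn_intercalate false (fun l hl => ?_) hls_ne
    rcases List.mem_append.1 hl with hl | hl
    · obtain ⟨k, -, rfl⟩ := List.mem_map.1 hl
      simp
    · simp [List.eq_of_mem_replicate hl]
  obtain ⟨ξ, hξ⟩ : ∃ ξ : Fin N → Bool, List.ofFn ξ = [false].intercalate ls := by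
    generalize [false].intercalate ls = l at hlen
    subst hlen
    exact ⟨l.get, List.ofFn_get l⟩
  refine ⟨ξ, ?_, ?_⟩
  · have : true ∈ List.ofFn ξ := by
      obtain ⟨k, hk⟩ := List.exists_mem_of_ne_nil L hne
      rw [hξ, List.mem_intercalate_singleton_of_ne (by decide)]
      refine ⟨List.replicate k true, List.mem_append_left _ (List.mem_map_of_mem hk), ?_⟩
      exact List.mem_replicate.2 ⟨fun h => h0 (h ▸ hk), rfl⟩
    exact List.mem_ofFn.1 this
  · have hL : L.filter (· ≠ 0) = L :=
      List.filter_eq_self.2 fun a ha => by simpa using fun h : a = 0 => h0 (h ▸ ha)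
    rw [runType, hξ, hsplit, hmap, List.filter_append, hL]
    simp

theorem image_runType_eq_runTypes (N : ℕ) :
    (Finset.univ.filter (fun ξ : Fin N → Bool => ∃ i, ξ i = true)).image runType
      = runTypes N := by
  ext m
  simp only [Finset.mem_image, Finset.mem_filter, Finset.mem_univ, true_and]
  constructor
  · rintro ⟨ξ, hξ, rfl⟩
    exact runType_mem_runTypes hξ
  · exact exists_runType_eq

/-- For every positive integer `N`:
`∑_{r=1}^{N} ∑_{M=1}^{min(r, N-r+1)} p(r, M) = p(N+1) - 1`, and equivalently the number
`ν(N)` of equivalence classes of binary sequences of length `N` containing at least one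
success (sequences being equivalent iff they have the same multiset of success-run lengths,
so that the classes are in bijection with the distinct run-types) equals `p(N+1) - 1`. -/
theorem sum_partCountEq_and_card_runTypes_eq_partCount_succ_sub_one (N : ℕ) (hN : 1 ≤ N) :
    (∑ r ∈ Finset.Icc 1 N, ∑ M ∈ Finset.Icc 1 (min r (N - r + 1)), partCountEq r M
        = partCount (N + 1) - 1) ∧
    (((Finset.univ.filter (fun ξ : Fin N → Bool => ∃ i, ξ i = true)).image runType).card
        = partCount (N + 1) - 1) := by
  exact ⟨(sum_partCountEq_eq_card_runTypes N).trans (card_runTypes N),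
    (congrArg Finset.card (image_runType_eq_runTypes N)).trans (card_runTypes N)⟩
end

section
/- As N → ∞, the quantity ν(N) = p(N+1) − 1 is asymptotically equivalent to exp(π·√(2(N+1)/3)) / (4·√3·(N+1)); i.e., the ratio of ν(N) to this expression tends to 1. -/
open Filter

/-- `ν(N) = p(N+1) - 1`, the number of inequivalent Bernoulli sequences of length `N`
containing at least one success. -/
def nu (N : ℕ) : ℕ := partCount (N + 1) - 1

open PowerSeries in
/-- The geometric series `∑ X ^ ((i + 1) * j)`, the `i`-th factor of the partition generating
function. -/
noncomputable def geomFactor (i : ℕ) : ℕ⟦X⟧ :=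
  PowerSeries.mk fun n => if i + 1 ∣ n then 1 else 0

open PowerSeries in
/-- The generating function of the partitions with all parts at most `k`. -/
noncomputable def truncPartSeries (k : ℕ) : ℕ⟦X⟧ := ∏ i ∈ Finset.range k, geomFactor i

open PowerSeries PowerSeries.WithPiTopology in
theorem hasProd_geomFactor :
    HasProd geomFactor (PowerSeries.mk fun n => partCount n) := by
  have h := Nat.Partition.hasProd_powerSeriesMk_card_restricted ℕ (fun _ => True)
  have hgeom : ∀ i : ℕ, ∑' j : ℕ, (X : ℕ⟦X⟧) ^ ((i + 1) * j) = geomFactor i := by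
    intro i
    refine HasSum.tsum_eq ?_
    rw [hasSum_iff_hasSum_coeff]
    intro d
    simp only [geomFactor, coeff_mk, coeff_X_pow]
    by_cases hd : i + 1 ∣ d
    · obtain ⟨m, rfl⟩ := hd
      have hm : ∀ j, j ≠ m → (if (i + 1) * m = (i + 1) * j then 1 else 0) = 0 := fun j hj => by
        simp [hj.symm]
      simpa using hasSum_single m hm
    · have hz : (fun j => if d = (i + 1) * j then 1 else 0) = fun _ : ℕ => 0 := by
        funext j
        rw [if_neg]
        rintro rfl
        exact hd (dvd_mul_right _ _)
      simpa only [hz, if_neg hd] using hasSum_zero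
  simpa [hgeom, partCount, Nat.Partition.restricted, Finset.card_univ] using h

open PowerSeries.WithPiTopology in
theorem tendsto_coeff_truncPartSeries (n : ℕ) :
    Tendsto (fun k => (truncPartSeries k).coeff n) atTop (nhds (partCount n)) := by
  have h := hasProd_geomFactor.tendsto_prod_nat
  rw [PowerSeries.WithPiTopology.tendsto_iff_coeff_tendsto] at h
  simpa [truncPartSeries] using h n

theorem monotone_coeff_truncPartSeries (n : ℕ) :
    Monotone fun k => (truncPartSeries k).coeff n := by
  refine monotone_nat_of_le_succ fun k => ?_
  have h0 : (geomFactor k).coeff 0 = 1 := by simp [geomFactor]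
  calc (truncPartSeries k).coeff n
      = (truncPartSeries k).coeff n * (geomFactor k).coeff 0 := by rw [h0, mul_one]
    _ ≤ (truncPartSeries (k + 1)).coeff n := by
      rw [truncPartSeries, truncPartSeries, Finset.prod_range_succ, PowerSeries.coeff_mul]
      exact Finset.single_le_sum
        (f := fun x : ℕ × ℕ => ((∏ i ∈ Finset.range k, geomFactor i).coeff x.1) *
          (geomFactor k).coeff x.2)
        (fun _ _ => Nat.zero_le _) (a := (n, 0)) (by simp)

theorem coeff_truncPartSeries_le (k n : ℕ) : (truncPartSeries k).coeff n ≤ partCount n :=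
  (monotone_coeff_truncPartSeries n).ge_of_tendsto (tendsto_coeff_truncPartSeries n) k

theorem hasSum_geomFactor (i : ℕ) {q : ℂ} (hq : ‖q‖ < 1) :
    HasSum (fun n => ((geomFactor i).coeff n : ℂ) * q ^ n) (1 - q ^ (i + 1))⁻¹ := by
  have hi : Function.Injective fun j : ℕ => (i + 1) * j :=
    mul_right_injective₀ (Nat.succ_ne_zero i)
  rw [← hi.hasSum_iff]
  · have hq' : ‖q ^ (i + 1)‖ < 1 := by
      rw [norm_pow]
      exact pow_lt_one₀ (norm_nonneg _) hq (Nat.succ_ne_zero i)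
    refine (hasSum_geometric_of_norm_lt_one hq').congr_fun fun j => ?_
    simp [geomFactor, pow_mul]
  · intro n hn
    have : ¬ i + 1 ∣ n := fun ⟨m, hm⟩ => hn ⟨m, hm.symm⟩
    simp [geomFactor, this]

theorem summable_and_hasSum_truncPartSeries (k : ℕ) {q : ℂ} (hq : ‖q‖ < 1) :
    (Summable fun n => ‖((truncPartSeries k).coeff n : ℂ) * q ^ n‖) ∧
      HasSum (fun n => ((truncPartSeries k).coeff n : ℂ) * q ^ n)
        (∏ i ∈ Finset.range k, (1 - q ^ (i + 1))⁻¹) := by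
  induction k with
  | zero =>
    have h : ∀ n, n ≠ 0 → (((truncPartSeries 0).coeff n : ℕ) : ℂ) * q ^ n = 0 := fun n hn => by
      simp [truncPartSeries, PowerSeries.coeff_one, hn]
    refine ⟨summable_of_ne_finset_zero (s := {0}) fun n hn => ?_, ?_⟩
    · rw [h n (by simpa using hn), norm_zero]
    · simpa [truncPartSeries] using hasSum_single 0 h
  | succ k ih =>
    have hg := hasSum_geomFactor k hq
    have heq : ∀ n, (((truncPartSeries (k + 1)).coeff n : ℕ) : ℂ) * q ^ n =
        ∑ x ∈ Finset.HasAntidiagonal.antidiagonal n, (((truncPartSeries k).coeff x.1 : ℕ) : ℂ) * q ^ x.1 *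
          ((((geomFactor k).coeff x.2 : ℕ) : ℂ) * q ^ x.2) := by
      intro n
      rw [truncPartSeries, Finset.prod_range_succ, PowerSeries.coeff_mul, Nat.cast_sum,
        Finset.sum_mul]
      refine Finset.sum_congr rfl fun x hx => ?_
      rw [← Finset.HasAntidiagonal.mem_antidiagonal.mp hx, pow_add, Nat.cast_mul, truncPartSeries]
      ring
    rw [Finset.prod_range_succ, ← ih.2.tsum_eq, ← hg.tsum_eq, funext heq,
      tsum_mul_tsum_eq_tsum_sum_antidiagonal_of_summable_norm ih.1 hg.summable.norm]
    have hs := summable_norm_sum_mul_antidiagonal_of_summable_norm ih.1 hg.summable.norm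
    exact ⟨by simpa only [heq] using hs, hs.of_norm.hasSum⟩

theorem one_sub_pow_ne_zero {q : ℂ} (hq : ‖q‖ < 1) (i : ℕ) : 1 - q ^ (i + 1) ≠ 0 := by
  intro h
  have h1 : ‖q ^ (i + 1)‖ < 1 := by
    rw [norm_pow]
    exact pow_lt_one₀ (norm_nonneg _) hq (Nat.succ_ne_zero i)
  rw [← sub_eq_zero.mp h, norm_one] at h1
  exact lt_irrefl _ h1

theorem tprod_one_sub_pow_ne_zero {q : ℂ} (hq : ‖q‖ < 1) :
    ∏' i : ℕ, (1 - q ^ (i + 1)) ≠ 0 := by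
  simp_rw [sub_eq_add_neg]
  refine tprod_one_add_ne_zero_of_summable (fun i => ?_) ?_
  · rw [← sub_eq_add_neg]
    exact one_sub_pow_ne_zero hq i
  · simpa using (summable_nat_add_iff 1).mpr (summable_geometric_of_lt_one (norm_nonneg _) hq)

theorem tendsto_prod_inv_one_sub_pow {q : ℂ} (hq : ‖q‖ < 1) :
    Tendsto (fun k => ∏ i ∈ Finset.range k, (1 - q ^ (i + 1))⁻¹) atTop
      (nhds (∏' i : ℕ, (1 - q ^ (i + 1)))⁻¹) := by
  simp_rw [Finset.prod_inv_distrib]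
  exact (ModularForm.multipliable_one_sub_pow hq).hasProd.tendsto_prod_nat.inv₀
    (tprod_one_sub_pow_ne_zero hq)

theorem summable_partCount_mul_pow {r : ℝ} (hr0 : 0 ≤ r) (hr1 : r < 1) :
    Summable fun n => (partCount n : ℝ) * r ^ n := by
  have hr : ‖(r : ℂ)‖ < 1 := by simpa [abs_of_nonneg hr0] using hr1
  obtain ⟨C, hC⟩ := (tendsto_prod_inv_one_sub_pow hr).norm.bddAbove_range
  refine summable_of_sum_range_le (c := C) (fun n => by positivity) fun M => ?_
  have hlim : Tendsto (fun k => ∑ n ∈ Finset.range M, ((truncPartSeries k).coeff n : ℝ) * r ^ n)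
      atTop (nhds (∑ n ∈ Finset.range M, (partCount n : ℝ) * r ^ n)) :=
    tendsto_finsetSum _ fun n _ => Tendsto.mul_const _
      ((continuous_of_discreteTopology (f := ((↑) : ℕ → ℝ))).continuousAt.tendsto.comp
        (tendsto_coeff_truncPartSeries n))
  refine le_of_tendsto' hlim fun k => ?_
  obtain ⟨hs, hsum⟩ := summable_and_hasSum_truncPartSeries k hr
  have hterm : ∀ n, ‖((truncPartSeries k).coeff n : ℂ) * (r : ℂ) ^ n‖ =
      ((truncPartSeries k).coeff n : ℝ) * r ^ n := fun n => by simp [abs_of_nonneg hr0]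
  have hreal : ‖∏ i ∈ Finset.range k, (1 - (r : ℂ) ^ (i + 1))⁻¹‖ =
      ∑' n, ((truncPartSeries k).coeff n : ℝ) * r ^ n := by
    rw [← hsum.tsum_eq]
    have : ∑' n, ((truncPartSeries k).coeff n : ℂ) * (r : ℂ) ^ n =
        ((∑' n, ((truncPartSeries k).coeff n : ℝ) * r ^ n : ℝ) : ℂ) := by
      push_cast
      rfl
    rw [this, Complex.norm_real, Real.norm_of_nonneg (tsum_nonneg fun n => by positivity)]
  simp_rw [hterm] at hs
  calc ∑ n ∈ Finset.range M, ((truncPartSeries k).coeff n : ℝ) * r ^ n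
      ≤ ∑' n, ((truncPartSeries k).coeff n : ℝ) * r ^ n :=
        hs.sum_le_tsum _ fun n _ => by positivity
    _ ≤ C := by
      rw [← hreal]
      exact hC ⟨k, rfl⟩

/-- The partition generating function `∑ p(n) q ^ n` on the open unit disc. -/
noncomputable def partGen (q : ℂ) : ℂ := ∑' n, (partCount n : ℂ) * q ^ n

/-- Euler's product formula for the partition generating function. -/
theorem partGen_eq_inv_tprod {q : ℂ} (hq : ‖q‖ < 1) :
    partGen q = (∏' i : ℕ, (1 - q ^ (i + 1)))⁻¹ := by
  refine tendsto_nhds_unique ?_ (tendsto_prod_inv_one_sub_pow hq)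
  simp_rw [← fun k => (summable_and_hasSum_truncPartSeries k hq).2.tsum_eq]
  refine tendsto_tsum_of_dominated_convergence
    (summable_partCount_mul_pow (norm_nonneg q) hq) (fun n => ?_) (.of_forall fun k n => ?_)
  · exact Tendsto.mul_const _
      ((continuous_of_discreteTopology (f := ((↑) : ℕ → ℂ))).continuousAt.tendsto.comp
        (tendsto_coeff_truncPartSeries n))
  · rw [norm_mul, norm_pow, Complex.norm_natCast]
    gcongr
    exact coeff_truncPartSeries_le k n

theorem norm_partGen_le {q : ℂ} {r : ℝ} (hqr : ‖q‖ ≤ r) (hr : r < 1) :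
    ‖partGen q‖ ≤ ‖partGen r‖ := by
  have hr0 : 0 ≤ r := (norm_nonneg q).trans hqr
  have hs := summable_partCount_mul_pow hr0 hr
  have hreal : ‖partGen r‖ = ∑' n, (partCount n : ℝ) * r ^ n := by
    have : partGen r = ((∑' n, (partCount n : ℝ) * r ^ n : ℝ) : ℂ) := by
      rw [partGen]
      push_cast
      rfl
    rw [this, Complex.norm_real, Real.norm_of_nonneg (tsum_nonneg fun n => by positivity)]
  rw [hreal]
  refine tsum_of_norm_bounded hs.hasSum fun n => ?_
  rw [norm_mul, norm_pow, Complex.norm_natCast]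
  gcongr

theorem tendsto_partGen_zero : Tendsto partGen (nhds 0) (nhds 1) := by
  have h1 : (1 : ℂ) = ∑' n, (partCount n : ℂ) * 0 ^ n := by
    rw [tsum_eq_single 0 fun n hn => by simp [hn]]
    simp [partCount]
  rw [h1]
  refine tendsto_tsum_of_dominated_convergence (bound := fun n => (partCount n : ℝ) * (1 / 2) ^ n)
    (summable_partCount_mul_pow (by norm_num) (by norm_num)) (fun n => ?_) ?_
  · exact (Continuous.tendsto (by fun_prop) _)
  · filter_upwards [Metric.closedBall_mem_nhds (0 : ℂ) (by norm_num : (0 : ℝ) < 1 / 2)] with q hq n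
    rw [norm_mul, norm_pow, Complex.norm_natCast]
    gcongr
    simpa using hq

theorem continuousOn_partGen : ContinuousOn partGen (Metric.ball 0 1) := by
  have h : ContinuousOn (fun q : ℂ => (∏' i : ℕ, (1 - q ^ (i + 1)))⁻¹) (Metric.ball 0 1) :=
    ModularForm.differentiableOn_tprod_one_sub_pow.continuousOn.inv₀ fun q hq =>
      tprod_one_sub_pow_ne_zero (by simpa using hq)
  exact h.congr fun q hq => partGen_eq_inv_tprod (by simpa using hq)

theorem norm_inv_one_sub_le {z : ℂ} (hz : ‖z‖ < 1) :
    ‖(1 - z)⁻¹‖ ≤ ‖(1 - (‖z‖ : ℂ))⁻¹‖ * Real.exp (z.re - ‖z‖) := by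
  have key : ∀ w : ℂ, ‖w‖ < 1 → ‖(1 - w)⁻¹‖ = Real.exp (-Complex.log (1 - w)).re := fun w hw => by
    have hw1 : 1 - w ≠ 0 := fun h => by
      rw [← sub_eq_zero.mp h, norm_one] at hw
      exact lt_irrefl _ hw
    rw [← Complex.norm_exp, Complex.exp_neg, Complex.exp_log hw1]
  have hz' : ‖(‖z‖ : ℂ)‖ < 1 := by simpa using hz
  rw [key z hz, key _ hz', ← Real.exp_add, Real.exp_le_exp]
  have h := ((Complex.hasSum_taylorSeries_neg_log hz').sub
    (Complex.hasSum_taylorSeries_neg_log hz)).mapL Complex.reCLM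
  have hterm : ∀ n : ℕ, 0 ≤ Complex.reCLM ((‖z‖ : ℂ) ^ n / n - z ^ n / n) := fun n => by
    rw [← sub_div, Complex.reCLM_apply, Complex.div_natCast_re, Complex.sub_re,
      ← Complex.ofReal_pow, Complex.ofReal_re, ← norm_pow]
    exact div_nonneg (sub_nonneg.mpr (Complex.re_le_norm _)) (Nat.cast_nonneg _)
  have h1 := le_hasSum h 1 fun n _ => hterm n
  simp only [pow_one, Nat.cast_one, div_one, Complex.reCLM_apply, Complex.sub_re,
    Complex.ofReal_re] at h1
  linarith

theorem norm_partGen_le_mul_exp {q : ℂ} (hq : ‖q‖ < 1) :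
    ‖partGen q‖ ≤
      ‖partGen ‖q‖‖ * Real.exp ((q / (1 - q)).re - ‖q‖ / (1 - ‖q‖)) := by
  have hq' : ‖(‖q‖ : ℂ)‖ < 1 := by simpa using hq
  have hsum : ∀ w : ℂ, ‖w‖ < 1 → HasSum (fun i : ℕ => w ^ (i + 1)) (w / (1 - w)) := fun w hw => by
    simpa [pow_succ', div_eq_mul_inv] using (hasSum_geometric_of_norm_lt_one hw).mul_left w
  have hre := ((hsum q hq).sub (hsum _ hq')).mapL Complex.reCLM
  have hval : Complex.reCLM (q / (1 - q) - (‖q‖ : ℂ) / (1 - (‖q‖ : ℂ))) =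
      (q / (1 - q)).re - ‖q‖ / (1 - ‖q‖) := by
    rw [Complex.reCLM_apply, Complex.sub_re]
    norm_cast
  rw [hval] at hre
  rw [partGen_eq_inv_tprod hq, partGen_eq_inv_tprod hq']
  refine le_of_tendsto_of_tendsto' (tendsto_prod_inv_one_sub_pow hq).norm
    ((tendsto_prod_inv_one_sub_pow hq').norm.mul
      (Real.continuous_exp.continuousAt.tendsto.comp hre.tendsto_sum_nat)) fun k => ?_
  rw [norm_prod, norm_prod, Function.comp_apply, Real.exp_sum, ← Finset.prod_mul_distrib]
  refine Finset.prod_le_prod (fun i _ => norm_nonneg _) fun i _ => ?_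
  have hi : ‖q ^ (i + 1)‖ < 1 := by
    rw [norm_pow]
    exact pow_lt_one₀ (norm_nonneg _) hq (Nat.succ_ne_zero i)
  have h := norm_inv_one_sub_le hi
  rw [Complex.reCLM_apply, Complex.sub_re, ← Complex.ofReal_pow, Complex.ofReal_re, ← norm_pow]
  exact h

/-- The nome `exp (2 π i τ)`. -/
noncomputable def nome (τ : ℂ) : ℂ := Complex.exp (2 * Real.pi * Complex.I * τ)

theorem continuous_nome : Continuous nome := by
  unfold nome
  fun_prop

theorem norm_nome (τ : ℂ) : ‖nome τ‖ = Real.exp (-(2 * Real.pi * τ.im)) := by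
  rw [nome, Complex.norm_exp]
  simp

theorem norm_nome_lt_one {τ : ℂ} (hτ : 0 < τ.im) : ‖nome τ‖ < 1 := by
  rw [norm_nome, Real.exp_lt_one_iff]
  have := Real.pi_pos
  simp only [neg_lt_zero]
  positivity

/-- The modular transformation of the partition generating function under `τ ↦ -1 / τ`. -/
theorem partGen_nome {τ : ℂ} (hτ : 0 < τ.im) :
    partGen (nome τ) = nome (τ / 24) * (Complex.sqrt τ / Complex.sqrt Complex.I) *
      nome (1 / (24 * τ)) * partGen (nome (-1 / τ)) := by
  have hτ0 : τ ≠ 0 := fun h => by simp [h] at hτ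
  have him : 0 < (-1 / τ).im := by
    rw [neg_div, one_div, Complex.neg_im, Complex.inv_im]
    have := Complex.normSq_pos.mpr hτ0
    rw [neg_div, neg_neg]
    positivity
  have heta : ∀ w : ℂ, 0 < w.im → ModularForm.eta w = nome (w / 24) * (partGen (nome w))⁻¹ :=
    fun w hw => by
      rw [partGen_eq_inv_tprod (norm_nome_lt_one hw), inv_inv, ModularForm.eta]
      simp only [ModularForm.eta_q_eq_pow, Function.Periodic.qParam, nome]
      congr 2
      push_cast
      ring
  have hne : ∀ w : ℂ, 0 < w.im → partGen (nome w) ≠ 0 := fun w hw => by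
    rw [partGen_eq_inv_tprod (norm_nome_lt_one hw)]
    exact inv_ne_zero (tprod_one_sub_pow_ne_zero (norm_nome_lt_one hw))
  have h := ModularForm.eta_comp_eq_csqrt_I_inv (show τ ∈ UpperHalfPlane.upperHalfPlaneSet from hτ)
  simp only [Function.comp_apply, Pi.smul_apply, Pi.mul_apply, smul_eq_mul] at h
  rw [heta _ hτ, heta _ him] at h
  have hI : Complex.sqrt Complex.I ≠ 0 := by simp [Complex.sqrt]
  have hinv : nome (1 / (24 * τ)) * nome (-1 / τ / 24) = 1 := by
    rw [nome, nome, ← Complex.exp_add, Complex.exp_eq_one_iff]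
    refine ⟨0, ?_⟩
    field_simp
    simp
  have h1 := hne _ hτ
  have h2 := hne _ him
  generalize nome (1 / (24 * τ)) = a at *
  generalize nome (-1 / τ / 24) = b at *
  generalize partGen (nome (-1 / τ)) = P at *
  generalize nome (τ / 24) = c at *
  field_simp at h ⊢
  linear_combination a * h - Complex.sqrt Complex.I * partGen (nome τ) * hinv

theorem nome_add (σ τ : ℂ) : nome (σ + τ) = nome σ * nome τ := by
  rw [nome, nome, nome, ← Complex.exp_add]
  ring_nf

theorem nome_nat_mul (n : ℕ) (τ : ℂ) : nome (n * τ) = nome τ ^ n := by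
  rw [nome, nome, ← Complex.exp_nat_mul]
  ring_nf

theorem integral_nome_int_mul {k : ℤ} (hk : k ≠ 0) (y : ℝ) :
    ∫ x in (-1 / 2 : ℝ)..1 / 2, nome (k * (x + y * Complex.I)) = 0 := by
  have hc : 2 * Real.pi * Complex.I * k ≠ 0 :=
    mul_ne_zero Complex.two_pi_I_ne_zero (Int.cast_ne_zero.mpr hk)
  have h : ∀ x : ℝ, nome (k * (x + y * Complex.I)) =
      Complex.exp (2 * Real.pi * Complex.I * k * x) * nome (k * (y * Complex.I)) := fun x => by
    rw [mul_add, nome_add, nome]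
    ring_nf
  simp_rw [h]
  rw [intervalIntegral.integral_mul_const, integral_exp_mul_complex hc]
  have hper : Complex.exp (2 * Real.pi * Complex.I * k * ((1 / 2 : ℝ) : ℂ)) =
      Complex.exp (2 * Real.pi * Complex.I * k * ((-1 / 2 : ℝ) : ℂ)) := by
    rw [Complex.exp_eq_exp_iff_exists_int]
    refine ⟨k, ?_⟩
    push_cast
    ring
  rw [hper, sub_self, zero_div, zero_mul]

/-- Cauchy's formula for the number of partitions, as an integral over a horizontal segment. -/
theorem partCount_eq_integral (n : ℕ) {y : ℝ} (hy : 0 < y) :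
    (partCount n : ℂ) = ∫ x in (-1 / 2 : ℝ)..1 / 2,
      partGen (nome (x + y * Complex.I)) * nome (-(n * (x + y * Complex.I))) := by
  have him : ∀ x : ℝ, ((x : ℂ) + y * Complex.I).im = y := fun x => by simp
  have hnorm : ∀ x : ℝ, ‖nome (x + y * Complex.I)‖ = Real.exp (-(2 * Real.pi * y)) := fun x => by
    rw [norm_nome, him]
  have hr1 : Real.exp (-(2 * Real.pi * y)) < 1 := by
    rw [← hnorm 0]
    exact norm_nome_lt_one (by rwa [him])
  have hs := summable_partCount_mul_pow (Real.exp_pos _).le hr1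
  have hnorm' : ∀ x : ℝ, ‖nome (-(n * (x + y * Complex.I)))‖ = Real.exp (2 * Real.pi * (n * y)) :=
    fun x => by
      rw [norm_nome]
      simp
  have hsum := intervalIntegral.hasSum_integral_of_dominated_convergence
    (μ := MeasureTheory.volume) (a := (-1 / 2 : ℝ)) (b := 1 / 2)
    (F := fun (m : ℕ) (x : ℝ) => (partCount m : ℂ) * nome (x + y * Complex.I) ^ m *
      nome (-(n * (x + y * Complex.I))))
    (f := fun x : ℝ => partGen (nome (x + y * Complex.I)) * nome (-(n * (x + y * Complex.I))))
    (fun m _ => partCount m * Real.exp (-(2 * Real.pi * y)) ^ m * Real.exp (2 * Real.pi * (n * y)))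
    (fun m => ?_) (fun m => .of_forall fun x _ => ?_) (.of_forall fun x _ => hs.mul_right _) ?_
    (.of_forall fun x _ => ?_)
  · refine HasSum.unique ?_ hsum
    have hterm : ∀ m : ℕ, ∀ x : ℝ, (partCount m : ℂ) * nome (x + y * Complex.I) ^ m *
        nome (-(n * (x + y * Complex.I))) =
        partCount m * nome (((m - n : ℤ) : ℂ) * (x + y * Complex.I)) := fun m x => by
      rw [mul_assoc, ← nome_nat_mul, ← nome_add]
      push_cast
      ring_nf
    simp_rw [hterm, intervalIntegral.integral_const_mul]
    have h0 : ∀ m : ℕ, m ≠ n → (partCount m : ℂ) *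
        ∫ x in (-1 / 2 : ℝ)..1 / 2, nome (((m - n : ℤ) : ℂ) * (x + y * Complex.I)) = 0 :=
      fun m hm => by
        rw [integral_nome_int_mul (by omega), mul_zero]
    have hn : (partCount n : ℂ) *
        ∫ x in (-1 / 2 : ℝ)..1 / 2, nome (((n - n : ℤ) : ℂ) * (x + y * Complex.I)) =
        partCount n := by
      norm_num [nome]
    have h := hasSum_single n h0
    rwa [hn] at h
  · have := continuous_nome
    exact Continuous.aestronglyMeasurable (by fun_prop)
  · rw [norm_mul, norm_mul, norm_pow, hnorm, hnorm', Complex.norm_natCast]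
  · exact intervalIntegrable_const
  · refine HasSum.mul_right _ (Summable.hasSum ?_)
    refine Summable.of_norm ?_
    simpa [hnorm] using hs

theorem norm_nome_le_half {τ : ℂ} (hτ : 1 / 2 ≤ τ.im) : ‖nome τ‖ ≤ 1 / 2 := by
  have h2 : (2 : ℝ) ≤ Real.exp 1 := by linarith [Real.add_one_le_exp (1 : ℝ)]
  calc ‖nome τ‖ ≤ Real.exp (-1) := by
        rw [norm_nome, Real.exp_le_exp]
        nlinarith [Real.pi_gt_three]
    _ ≤ 1 / 2 := by
      rw [Real.exp_neg, one_div]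
      exact inv_anti₀ (by norm_num) h2

theorem norm_csqrt (z : ℂ) : ‖Complex.sqrt z‖ = √‖z‖ := by
  have : Complex.sqrt z = z ^ ((2⁻¹ : ℝ) : ℂ) := by simp [Complex.sqrt]
  rw [this, Complex.norm_cpow_real, Real.sqrt_eq_rpow, one_div]

theorem norm_partGen_nome_imag_le {y : ℝ} (hy : 0 < y) (hy1 : y ≤ 1) :
    ‖partGen (nome (y * Complex.I))‖ ≤
      ‖partGen (1 / 2 : ℝ)‖ * Real.exp (Real.pi / (12 * y)) := by
  have h1 : ‖nome (y * Complex.I / 24)‖ ≤ 1 := by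
    rw [norm_nome, Real.exp_le_one_iff]
    have := Real.pi_pos
    have : (y * Complex.I / 24).im = y / 24 := by simp [Complex.div_ofNat_im]
    rw [this, neg_nonpos]
    positivity
  have h2 : ‖Complex.sqrt (y * Complex.I) / Complex.sqrt Complex.I‖ ≤ 1 := by
    rw [norm_div, norm_csqrt, norm_csqrt]
    simpa [abs_of_pos hy] using hy1
  have hinv : (1 / (y * Complex.I) : ℂ) = ((-(1 / y) : ℝ) : ℂ) * Complex.I := by
    have : (y : ℂ) ≠ 0 := by exact_mod_cast hy.ne'
    push_cast
    field_simp
    simp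
  have h3 : ‖nome (1 / (24 * (y * Complex.I)))‖ = Real.exp (Real.pi / (12 * y)) := by
    rw [norm_nome]
    have : (1 / (24 * (y * Complex.I)) : ℂ) = ((-(1 / (24 * y)) : ℝ) : ℂ) * Complex.I := by
      have : (y : ℂ) ≠ 0 := by exact_mod_cast hy.ne'
      push_cast
      field_simp
      simp
    rw [this, Complex.im_ofReal_mul, Complex.I_im]
    congr 1
    field_simp
    ring
  have h4 : ‖nome (-1 / (y * Complex.I))‖ ≤ 1 / 2 := by
    refine norm_nome_le_half ?_
    rw [neg_div, hinv, Complex.neg_im, Complex.im_ofReal_mul, Complex.I_im]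
    have : 1 ≤ 1 / y := by rwa [le_div_iff₀ hy, one_mul]
    linarith
  rw [partGen_nome (by simpa using hy), norm_mul, norm_mul, norm_mul, h3]
  calc _ ≤ 1 * 1 * Real.exp (Real.pi / (12 * y)) * ‖partGen (1 / 2 : ℝ)‖ := by
        gcongr
        exact norm_partGen_le h4 (by norm_num)
    _ = _ := by ring

theorem norm_one_sub_nome_sq (x y : ℝ) :
    ‖1 - nome (x + y * Complex.I)‖ ^ 2 = (1 - Real.exp (-(2 * Real.pi * y))) ^ 2 +
      4 * Real.exp (-(2 * Real.pi * y)) * Real.sin (Real.pi * x) ^ 2 := by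
  have h : nome (x + y * Complex.I) = (Real.exp (-(2 * Real.pi * y)) : ℂ) *
      Complex.exp ((2 * (Real.pi * x) : ℝ) * Complex.I) := by
    rw [nome, Complex.ofReal_exp, ← Complex.exp_add]
    congr 1
    push_cast
    linear_combination (2 * Real.pi * y : ℂ) * Complex.I_sq
  rw [h, ← Complex.normSq_eq_norm_sq, Complex.normSq_apply]
  simp only [Complex.sub_re, Complex.sub_im, Complex.one_re, Complex.one_im,
    Complex.re_ofReal_mul, Complex.im_ofReal_mul, Complex.exp_ofReal_mul_I_re,
    Complex.exp_ofReal_mul_I_im]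
  have h1 := Real.sin_sq_add_cos_sq (2 * (Real.pi * x))
  have h2 := Real.cos_two_mul (Real.pi * x)
  have h3 := Real.sin_sq_add_cos_sq (Real.pi * x)
  generalize Real.exp (-(2 * Real.pi * y)) = r at *
  linear_combination r ^ 2 * h1 - 2 * r * h2 - 4 * r * h3

/-- Away from the positive real axis the partition generating function is exponentially smaller
than its maximum on the circle. -/
theorem norm_partGen_nome_le_of_le_abs {x y : ℝ} (hy : 0 < y) (hy1 : y ≤ 1 / 100) (hxy : y ≤ |x|)
    (hx : |x| ≤ 1 / 2) :
    ‖partGen (nome (x + y * Complex.I))‖ ≤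
      ‖partGen (1 / 2 : ℝ)‖ * Real.exp (Real.pi / (12 * y) - 1 / (100 * y)) := by
  set q := nome (x + y * Complex.I) with hqdef
  set r := Real.exp (-(2 * Real.pi * y)) with hr
  have hpi := Real.pi_gt_three
  have hpi' := Real.pi_lt_d2
  have hqr : ‖q‖ = r := by
    rw [hqdef, norm_nome]
    simp [hr]
  have hr0 : 0 < r := Real.exp_pos _
  have hr1 : r < 1 := by
    rw [hr, Real.exp_lt_one_iff]
    nlinarith
  have hry : 1 - r ≤ 6.3 * y := by
    have := Real.add_one_le_exp (-(2 * Real.pi * y))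
    nlinarith
  have hr9 : 0.9 ≤ r := by linarith
  have hsin : 4 * y ^ 2 ≤ Real.sin (Real.pi * x) ^ 2 := by
    have h := Real.mul_le_sin (x := Real.pi * |x|) (by positivity) (by nlinarith)
    have h1 : 2 / Real.pi * (Real.pi * |x|) = 2 * |x| := by field_simp
    have h2 : Real.sin (Real.pi * |x|) ^ 2 = Real.sin (Real.pi * x) ^ 2 := by
      rcases abs_choice x with h | h <;> rw [h]
      rw [mul_neg, Real.sin_neg, neg_sq]
    rw [h1] at h
    rw [← h2]
    nlinarith
  have hd : 1.16 * (1 - r) ≤ ‖1 - q‖ := by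
    refine (pow_le_pow_iff_left₀ (by linarith) (norm_nonneg _) two_ne_zero).mp ?_
    rw [hqdef, norm_one_sub_nome_sq, ← hr]
    have h1 : (1 - r) ^ 2 ≤ (6.3 * y) ^ 2 := by gcongr
    have h2 : 4 * 0.9 * (4 * y ^ 2) ≤ 4 * r * Real.sin (Real.pi * x) ^ 2 := by gcongr
    nlinarith
  have hre : (q / (1 - q)).re ≤ r / (1.16 * (1 - r)) := by
    refine (Complex.re_le_norm _).trans ?_
    rw [norm_div, hqr]
    gcongr
  have hexp : (q / (1 - q)).re - r / (1 - r) ≤ -(1 / (100 * y)) := by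
    have h1 : r / (1.16 * (1 - r)) = r / (1 - r) / 1.16 := by
      rw [div_div, mul_comm]
    have h2 : 0.9 / (6.3 * y) ≤ r / (1 - r) := by
      gcongr
    have h3 : 1 / (100 * y) = (0.9 / (6.3 * y)) * 0.07 := by
      field_simp
      norm_num
    rw [h1] at hre
    have h4 : 0 ≤ 0.9 / (6.3 * y) := by positivity
    rw [h3]
    generalize r / (1 - r) = X at *
    generalize 0.9 / (6.3 * y) = Y at *
    norm_num at hre ⊢
    linarith
  have hreal : (‖q‖ : ℂ) = nome (y * Complex.I) := by
    rw [hqr, hr, nome, Complex.ofReal_exp]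
    congr 1
    push_cast
    linear_combination (-2 * Real.pi * y : ℂ) * Complex.I_sq
  have h := norm_partGen_le_mul_exp (q := q) (by rwa [hqr])
  rw [hreal, hqr] at h
  refine h.trans ?_
  rw [sub_eq_add_neg (Real.pi / (12 * y)), Real.exp_add, ← mul_assoc]
  exact mul_le_mul (norm_partGen_nome_imag_le hy (by linarith)) (Real.exp_le_exp.mpr hexp)
    (Real.exp_pos _).le (by positivity)

/-- The slowly varying factor of the integrand of Cauchy's formula near the positive real axis, at
the point `τ = y * (u + I)`. -/
noncomputable def majorFactor (y u : ℝ) : ℂ :=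
  nome (y * (u + Complex.I) / 24) * (Complex.sqrt (u + Complex.I) / Complex.sqrt Complex.I) *
    partGen (nome (-1 / (y * (u + Complex.I))))

theorem im_neg_one_div (y u : ℝ) :
    (-1 / (y * (u + Complex.I)) : ℂ).im = (y * (u ^ 2 + 1))⁻¹ := by
  have h : (-1 / (y * (u + Complex.I)) : ℂ) = -((y⁻¹ : ℝ) * (u + Complex.I)⁻¹) := by
    rw [Complex.ofReal_inv, neg_div, one_div, mul_inv]
  rw [h, Complex.neg_im, Complex.im_ofReal_mul, Complex.inv_im, Complex.normSq_apply]
  simp only [Complex.add_re, Complex.add_im, Complex.ofReal_re, Complex.ofReal_im, Complex.I_re,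
    Complex.I_im]
  field_simp
  ring

theorem one_sub_mul_I_ne_zero (u : ℝ) : 1 - u * Complex.I ≠ 0 := fun h => by
  simpa using congrArg Complex.re h

theorem partGen_nome_mul_nome {n : ℕ} {y : ℝ} (hy : 0 < y) (hn : 24 * n * y ^ 2 = 1) (u : ℝ) :
    partGen (nome ((y * u : ℝ) + y * Complex.I)) *
        nome (-(n * ((y * u : ℝ) + y * Complex.I))) =
      √y * Real.exp (Real.pi / (6 * y)) * (majorFactor y u *
        Complex.exp (-(Real.pi / (12 * y) * u ^ 2 / (1 - u * Complex.I)))) := by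
  have hτ : ((y * u : ℝ) + y * Complex.I : ℂ) = y * (u + Complex.I) := by
    push_cast
    ring
  have hyc : (y : ℂ) ≠ 0 := by exact_mod_cast hy.ne'
  have hu := one_sub_mul_I_ne_zero u
  have huI : (u + Complex.I : ℂ) = Complex.I * (1 - u * Complex.I) := by
    linear_combination (u : ℂ) * Complex.I_sq
  have hnc : (n : ℂ) * y = 1 / (24 * y) := by
    field_simp
    exact_mod_cast by linarith
  have hsqrt : Complex.sqrt (y * (u + Complex.I)) = √y * Complex.sqrt (u + Complex.I) := by
    have hne : (u + Complex.I : ℂ) ≠ 0 := huI ▸ mul_ne_zero Complex.I_ne_zero hu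
    rw [Complex.sqrt, Complex.sqrt, Complex.cpow_def_of_ne_zero (mul_ne_zero hyc hne),
      Complex.cpow_def_of_ne_zero hne, Complex.log_ofReal_mul hy hne, add_mul, Complex.exp_add, Real.sqrt_eq_rpow,
      Real.rpow_def_of_pos hy]
    push_cast
    ring_nf
  have hexp : nome (1 / (24 * (y * (u + Complex.I)))) * nome (-(n * (y * (u + Complex.I)))) =
      Real.exp (Real.pi / (6 * y)) *
        Complex.exp (-(Real.pi / (12 * y) * u ^ 2 / (1 - u * Complex.I))) := by
    rw [nome, nome, Complex.ofReal_exp, ← Complex.exp_add, ← Complex.exp_add, ← mul_assoc (n : ℂ),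
      hnc, huI]
    have hw : (u : ℂ) ^ 2 = -((1 - u * Complex.I) - 1) ^ 2 := by
      linear_combination (u : ℂ) ^ 2 * Complex.I_sq
    have hI := Complex.I_ne_zero
    rw [hw]
    generalize 1 - u * Complex.I = w at hu ⊢
    congr 1
    push_cast
    field_simp
    ring_nf
    simp only [Complex.I_sq]
    ring
  rw [hτ, partGen_nome (by simpa using hy), hsqrt, majorFactor]
  linear_combination nome (y * (u + Complex.I) / 24) *
    (√y * Complex.sqrt (u + Complex.I) / Complex.sqrt Complex.I) *
    partGen (nome (-1 / (y * (u + Complex.I)))) * hexp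

theorem continuous_majorFactor {y : ℝ} (hy : 0 < y) : Continuous (majorFactor y) := by
  have hne : ∀ u : ℝ, (y * (u + Complex.I) : ℂ) ≠ 0 := fun u h => by
    have := congrArg Complex.im h
    simp [hy.ne'] at this
  have hsqrt : Continuous fun u : ℝ => Complex.sqrt (u + Complex.I) := by
    unfold Complex.sqrt
    refine Continuous.cpow (by fun_prop) continuous_const fun u => ?_
    simp [Complex.slitPlane]
  have hpart : Continuous fun u : ℝ => partGen (nome (-1 / (y * (u + Complex.I)))) := by
    refine continuousOn_partGen.comp_continuous
      (continuous_nome.comp (Continuous.div (by fun_prop) (by fun_prop) hne)) fun u => ?_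
    rw [mem_ball_zero_iff]
    refine norm_nome_lt_one ?_
    rw [im_neg_one_div]
    positivity
  have := continuous_nome
  unfold majorFactor
  fun_prop

theorem norm_majorFactor_le {y u : ℝ} (hy : 0 < y) (hy1 : y ≤ 1) (hu : |u| ≤ 1) :
    ‖majorFactor y u‖ ≤ √2 * ‖partGen (1 / 2 : ℝ)‖ := by
  have hu2 : u ^ 2 ≤ 1 := (sq_le_one_iff_abs_le_one u).mpr hu
  have h1 : ‖nome (y * (u + Complex.I) / 24)‖ ≤ 1 := by
    rw [norm_nome, Real.exp_le_one_iff]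
    have := Real.pi_pos
    have : (y * (u + Complex.I) / 24 : ℂ).im = y / 24 := by simp [Complex.div_ofNat_im]
    rw [this, neg_nonpos]
    positivity
  have h2 : ‖Complex.sqrt (u + Complex.I) / Complex.sqrt Complex.I‖ ≤ √2 := by
    rw [norm_div, norm_csqrt, norm_csqrt, Complex.norm_I, Real.sqrt_one, div_one]
    refine Real.sqrt_le_sqrt ((norm_add_le _ _).trans ?_)
    rw [Complex.norm_I, Complex.norm_real, Real.norm_eq_abs]
    linarith
  have h3 : ‖nome (-1 / (y * (u + Complex.I)))‖ ≤ 1 / 2 := by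
    refine norm_nome_le_half ?_
    rw [im_neg_one_div, one_div]
    exact inv_anti₀ (by positivity) (by nlinarith)
  rw [majorFactor, norm_mul, norm_mul]
  calc _ ≤ 1 * √2 * ‖partGen (1 / 2 : ℝ)‖ := by
        gcongr
        exact norm_partGen_le h3 (by norm_num)
    _ = _ := by ring

theorem tendsto_majorFactor {ι : Type*} {l : Filter ι} {y u : ι → ℝ}
    (hy : Tendsto y l (nhdsWithin 0 (Set.Ioi 0))) (hu : Tendsto u l (nhds 0)) :
    Tendsto (fun i => majorFactor (y i) (u i)) l (nhds 1) := by
  have hy0 : Tendsto y l (nhds 0) := hy.mono_right nhdsWithin_le_nhds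
  have hyc : Tendsto (fun i => (y i : ℂ)) l (nhds 0) := by
    simpa using hy0.ofReal
  have huc : Tendsto (fun i => (u i + Complex.I : ℂ)) l (nhds Complex.I) := by
    simpa using hu.ofReal.add_const Complex.I
  have h1 : Tendsto (fun i => nome (y i * (u i + Complex.I) / 24)) l (nhds 1) := by
    have h := (continuous_nome.tendsto _).comp ((hyc.mul huc).div_const 24)
    simpa [nome, Function.comp_def] using h
  have h2 : Tendsto (fun i => Complex.sqrt (u i + Complex.I) / Complex.sqrt Complex.I) l
      (nhds 1) := by
    have hI : Complex.sqrt Complex.I ≠ 0 := by simp [Complex.sqrt]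
    have hc : ContinuousAt Complex.sqrt Complex.I := by
      unfold Complex.sqrt
      exact continuousAt_id.cpow continuousAt_const (by simp [Complex.slitPlane])
    have h := (hc.tendsto.comp huc).div_const (Complex.sqrt Complex.I)
    rwa [div_self hI] at h
  have h3 : Tendsto (fun i => nome (-1 / (y i * (u i + Complex.I)))) l (nhds 0) := by
    rw [tendsto_zero_iff_norm_tendsto_zero]
    simp_rw [norm_nome, im_neg_one_div]
    refine Real.tendsto_exp_neg_atTop_nhds_zero.comp
      (Tendsto.const_mul_atTop Real.two_pi_pos (tendsto_inv_nhdsGT_zero.comp ?_))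
    refine tendsto_nhdsWithin_iff.mpr ⟨?_, ?_⟩
    · simpa using hy0.mul ((hu.pow 2).add_const 1)
    · filter_upwards [hy.eventually self_mem_nhdsWithin] with i hi
      have : 0 < y i := hi
      exact Set.mem_Ioi.mpr (by positivity)
  simpa [majorFactor] using (h1.mul h2).mul (tendsto_partGen_zero.comp h3)

theorem norm_exp_neg_div_le {c u : ℝ} (hc : 0 ≤ c) (hu : |u| ≤ 1) :
    ‖Complex.exp (-(c / (1 - u * Complex.I)))‖ ≤ Real.exp (-(1 / 2 * c)) := by
  have hu2 : u ^ 2 ≤ 1 := (sq_le_one_iff_abs_le_one u).mpr hu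
  have h : (c / (1 - u * Complex.I) : ℂ).re = c / (1 + u ^ 2) := by
    rw [div_eq_mul_inv, Complex.re_ofReal_mul, Complex.inv_re, Complex.normSq_apply]
    simp
    ring
  rw [Complex.norm_exp, Complex.neg_re, h, Real.exp_le_exp, neg_le_neg_iff, one_div,
    inv_mul_eq_div]
  gcongr
  linarith

/-- Laplace's method for the central part of the integral in Cauchy's formula. -/
theorem tendsto_sqrt_mul_integral_majorFactor :
    Tendsto (fun y : ℝ => (√(Real.pi / (12 * y)) : ℂ) * ∫ u in (-1 : ℝ)..1, majorFactor y u *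
      Complex.exp (-(Real.pi / (12 * y) * u ^ 2 / (1 - u * Complex.I))))
      (nhdsWithin 0 (Set.Ioi 0)) (nhds (√Real.pi : ℝ)) := by
  set l := nhdsWithin (0 : ℝ) (Set.Ioi 0)
  let s : ℝ → ℝ := fun y => √(Real.pi / (12 * y))
  have hpos : ∀ᶠ y : ℝ in l, 0 < y := self_mem_nhdsWithin
  have hle : ∀ᶠ y : ℝ in l, y ≤ 1 :=
    nhdsWithin_le_nhds (Iic_mem_nhds zero_lt_one)
  have hs : Tendsto s l atTop := by
    have h := (tendsto_inv_nhdsGT_zero (𝕜 := ℝ)).const_mul_atTop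
      (show 0 < Real.pi / 12 by positivity)
    refine Real.tendsto_sqrt_atTop.comp (h.congr fun y => ?_)
    rw [← div_eq_mul_inv, div_div]
  have hspos : ∀ᶠ y in l, 0 < s y := hs.eventually_gt_atTop 0
  let F : ℝ → ℝ → ℂ := fun y => (Set.Ioc (-s y) (s y)).indicator fun v =>
    majorFactor y (v / s y) * Complex.exp (-((v ^ 2 : ℝ) / (1 - (v / s y : ℝ) * Complex.I)))
  have hF : ∀ᶠ y in l, ∫ v, F y v = (√(Real.pi / (12 * y)) : ℂ) *
      ∫ u in (-1 : ℝ)..1, majorFactor y u *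
        Complex.exp (-(Real.pi / (12 * y) * u ^ 2 / (1 - u * Complex.I))) := by
    filter_upwards [hspos, hpos] with y hsy hy
    have h := intervalIntegral.integral_comp_div (a := -s y) (b := s y)
      (fun u : ℝ => majorFactor y u *
        Complex.exp (-(Real.pi / (12 * y) * u ^ 2 / (1 - u * Complex.I)))) hsy.ne'
    rw [neg_div, div_self hsy.ne', Complex.real_smul] at h
    rw [← h, MeasureTheory.integral_indicator measurableSet_Ioc,
      intervalIntegral.integral_of_le (by linarith)]
    congr 1
    funext v
    have hs2 : s y ^ 2 = Real.pi / (12 * y) := Real.sq_sqrt (by positivity)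
    have hv : (Real.pi / (12 * y) * ((v / s y : ℝ) : ℂ) ^ 2) = (v ^ 2 : ℝ) := by
      have : Real.pi / (12 * y) * (v / s y) ^ 2 = v ^ 2 := by
        rw [← hs2]
        field_simp
      exact_mod_cast this
    rw [hv]
  have hlim : ∫ v : ℝ, ((Real.exp (-1 * v ^ 2) : ℝ) : ℂ) = (√Real.pi : ℝ) := by
    rw [integral_complex_ofReal, integral_gaussian, div_one]
  have hu1 : ∀ y v : ℝ, 0 < s y → v ∈ Set.Ioc (-s y) (s y) → |v / s y| ≤ 1 := fun y v hsy hv => by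
    rw [abs_div, abs_of_pos hsy, div_le_one hsy]
    exact abs_le.mpr ⟨hv.1.le, hv.2⟩
  rw [← hlim]
  refine Tendsto.congr' hF (MeasureTheory.tendsto_integral_filter_of_dominated_convergence
    (fun v => √2 * ‖partGen (1 / 2 : ℝ)‖ * Real.exp (-(1 / 2) * v ^ 2)) ?_ ?_ ?_ ?_)
  · filter_upwards [hspos, hpos] with y hsy hy
    refine Measurable.aestronglyMeasurable (Measurable.indicator ?_ measurableSet_Ioc)
    have := continuous_majorFactor hy
    refine Continuous.measurable ?_
    have hd : Continuous fun v : ℝ => (((v ^ 2 : ℝ) : ℂ) / (1 - (v / s y : ℝ) * Complex.I)) :=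
      Continuous.div (by fun_prop) (by fun_prop) fun v => one_sub_mul_I_ne_zero _
    fun_prop
  · filter_upwards [hspos, hpos, hle] with y hsy hy hy1
    refine .of_forall fun v => ?_
    by_cases hv : v ∈ Set.Ioc (-s y) (s y)
    · have hu := hu1 y v hsy hv
      simp only [F, Set.indicator_of_mem hv]
      rw [norm_mul]
      gcongr
      · exact norm_majorFactor_le hy hy1 hu
      · simpa only [neg_mul] using norm_exp_neg_div_le (sq_nonneg v) hu
    · simp only [F, Set.indicator_of_notMem hv, norm_zero]
      positivity
  · exact (integrable_exp_neg_mul_sq (by norm_num)).const_mul _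
  · refine .of_forall fun v => ?_
    have hv : Tendsto (fun y => v / s y) l (nhds 0) := hs.const_div_atTop v
    have hvc : Tendsto (fun y => ((v / s y : ℝ) : ℂ)) l (nhds 0) := by
      simpa only [Complex.ofReal_zero] using hv.ofReal
    have h1 := tendsto_majorFactor (tendsto_id (α := ℝ) (x := l)) hv
    have h2 : Tendsto (fun y => Complex.exp (-((v ^ 2 : ℝ) / (1 - (v / s y : ℝ) * Complex.I)))) l
        (nhds (Complex.exp (-((v ^ 2 : ℝ) / (1 - 0 * Complex.I))))) :=
      (Complex.continuous_exp.tendsto _).comp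
        ((tendsto_const_nhds.div ((hvc.mul_const _).const_sub 1) (by simp)).neg)
    have h3 := h1.mul h2
    have hval : (1 : ℂ) * Complex.exp (-((v ^ 2 : ℝ) / (1 - 0 * Complex.I))) =
        ((Real.exp (-1 * v ^ 2) : ℝ) : ℂ) := by
      push_cast
      simp
    rw [hval] at h3
    refine h3.congr' ?_
    filter_upwards [hs.eventually_gt_atTop |v|] with y hy
    have hmem : v ∈ Set.Ioc (-s y) (s y) := ⟨(abs_lt.mp hy).1, (abs_lt.mp hy).2.le⟩
    simp only [F, Set.indicator_of_mem hmem, id]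

theorem tendsto_exp_neg_div_div_sq {c : ℝ} (hc : 0 < c) :
    Tendsto (fun y : ℝ => Real.exp (-(c / y)) / y ^ 2) (nhdsWithin 0 (Set.Ioi 0)) (nhds 0) := by
  have h := ((Real.tendsto_pow_mul_exp_neg_atTop_nhds_zero 2).comp
    ((tendsto_inv_nhdsGT_zero (𝕜 := ℝ)).const_mul_atTop hc)).div_const (c ^ 2)
  rw [zero_div] at h
  refine h.congr fun y => ?_
  simp only [Function.comp_apply, ← div_eq_mul_inv]
  field_simp

/-- Cauchy's formula, with the central part of the integral separated from the rest. -/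
theorem norm_partCount_sub_le {n : ℕ} {y : ℝ} (hy : 0 < y) (hy1 : y ≤ 1 / 100)
    (hn : 24 * n * y ^ 2 = 1) :
    ‖(partCount n : ℂ) - y * (√y * Real.exp (Real.pi / (6 * y)) *
      ∫ u in (-1 : ℝ)..1, majorFactor y u *
        Complex.exp (-(Real.pi / (12 * y) * u ^ 2 / (1 - u * Complex.I))))‖ ≤
      ‖partGen (1 / 2 : ℝ)‖ * Real.exp (Real.pi / (6 * y) - 1 / (100 * y)) := by
  set f : ℝ → ℂ := fun x => partGen (nome (x + y * Complex.I)) *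
    nome (-(n * (x + y * Complex.I))) with hf
  set M := ‖partGen (1 / 2 : ℝ)‖ * Real.exp (Real.pi / (6 * y) - 1 / (100 * y)) with hM
  have hnome := continuous_nome
  have hcont : Continuous f := by
    refine Continuous.mul (continuousOn_partGen.comp_continuous (by fun_prop) fun x => ?_)
      (by fun_prop)
    rw [mem_ball_zero_iff]
    exact norm_nome_lt_one (by simpa using hy)
  have hbound : ∀ x : ℝ, y ≤ |x| → |x| ≤ 1 / 2 → ‖f x‖ ≤ M := fun x hx hx2 => by
    have h1 := norm_partGen_nome_le_of_le_abs hy hy1 hx hx2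
    have h2 : ‖nome (-(n * (x + y * Complex.I)))‖ = Real.exp (Real.pi / (12 * y)) := by
      rw [norm_nome]
      congr 1
      have : (-(n * (x + y * Complex.I)) : ℂ).im = -(n * y) := by simp
      rw [this]
      field_simp
      linear_combination hn
    simp only [hf, norm_mul]
    rw [h2]
    calc _ ≤ _ := mul_le_mul_of_nonneg_right h1 (Real.exp_nonneg _)
      _ = M := by
        rw [hM, mul_assoc, ← Real.exp_add]
        congr 2
        field_simp
        ring
  have hcentral : ∫ x in (-y)..y, f x = y * (√y * Real.exp (Real.pi / (6 * y)) *
      ∫ u in (-1 : ℝ)..1, majorFactor y u *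
        Complex.exp (-(Real.pi / (12 * y) * u ^ 2 / (1 - u * Complex.I)))) := by
    have h := intervalIntegral.smul_integral_comp_mul_left (a := -1) (b := 1) f y
    rw [mul_neg, mul_one] at h
    rw [← h, Complex.real_smul]
    simp only [hf, partGen_nome_mul_nome hy hn, intervalIntegral.integral_const_mul]
  have hint : ∀ a b : ℝ, IntervalIntegrable f MeasureTheory.volume a b := fun a b =>
    hcont.intervalIntegrable a b
  have hleft : ‖∫ x in (-1 / 2 : ℝ)..(-y), f x‖ ≤ M * |-y - -1 / 2| :=
    intervalIntegral.norm_integral_le_of_norm_le_const fun x hx => by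
      rw [Set.uIoc_of_le (by linarith)] at hx
      have h := abs_of_nonpos (show x ≤ 0 by linarith [hx.2])
      exact hbound x (by linarith [hx.2]) (by linarith [hx.1])
  have hright : ‖∫ x in y..(1 / 2 : ℝ), f x‖ ≤ M * |1 / 2 - y| :=
    intervalIntegral.norm_integral_le_of_norm_le_const fun x hx => by
      rw [Set.uIoc_of_le (by linarith)] at hx
      have h := abs_of_nonneg (show 0 ≤ x by linarith [hx.1])
      exact hbound x (by linarith [hx.1]) (by linarith [hx.2])
  rw [abs_of_nonneg (by linarith)] at hleft hright
  have hM0 : 0 ≤ M := by positivity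
  rw [← hcentral, partCount_eq_integral n hy,
    ← intervalIntegral.integral_add_adjacent_intervals (hint (-1 / 2) (-y)) (hint (-y) (1 / 2)),
    ← intervalIntegral.integral_add_adjacent_intervals (hint (-y) y) (hint y (1 / 2))]
  calc _ = ‖(∫ x in (-1 / 2 : ℝ)..(-y), f x) + ∫ x in y..(1 / 2 : ℝ), f x‖ := by
        congr 1
        ring
    _ ≤ M * (-y - -1 / 2) + M * (1 / 2 - y) := (norm_add_le _ _).trans (add_le_add hleft hright)
    _ ≤ M := by nlinarith

/-- The Hardy–Ramanujan asymptotic formula, along any parametrization of `y = (24 n)^(-1/2)`. -/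
theorem tendsto_partCount_div {ι : Type*} {l : Filter ι} {n : ι → ℕ} {y : ι → ℝ}
    (hy : Tendsto y l (nhdsWithin 0 (Set.Ioi 0))) (hn : ∀ i, 24 * n i * y i ^ 2 = 1) :
    Tendsto (fun i => (partCount (n i) : ℝ) /
      (2 * √3 * y i ^ 2 * Real.exp (Real.pi / (6 * y i)))) l (nhds 1) := by
  have hpos : ∀ᶠ i in l, 0 < y i := hy.eventually self_mem_nhdsWithin
  have hle : ∀ᶠ i in l, y i ≤ 1 / 100 :=
    hy.eventually (nhdsWithin_le_nhds (Iic_mem_nhds (by norm_num)))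
  have hmain := (tendsto_sqrt_mul_integral_majorFactor.div_const (√Real.pi : ℂ)).comp hy
  have hpi : (√Real.pi : ℂ) ≠ 0 := by exact_mod_cast (Real.sqrt_pos.mpr Real.pi_pos).ne'
  rw [div_self hpi] at hmain
  have herr := ((tendsto_exp_neg_div_div_sq (c := 1 / 100) (by norm_num)).const_mul
    (‖partGen (1 / 2 : ℝ)‖ / (2 * √3))).comp hy
  rw [mul_zero] at herr
  have hdiff : Tendsto (fun i => (partCount (n i) : ℂ) /
      ((2 * √3 * y i ^ 2 * Real.exp (Real.pi / (6 * y i)) : ℝ) : ℂ) -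
      (√(Real.pi / (12 * y i)) * ∫ u in (-1 : ℝ)..1, majorFactor (y i) u *
        Complex.exp (-(Real.pi / (12 * y i) * u ^ 2 / (1 - u * Complex.I)))) / √Real.pi)
      l (nhds 0) := by
    refine squeeze_zero_norm' ?_ herr
    filter_upwards [hpos, hle] with i hi hi1
    have h := norm_partCount_sub_le hi hi1 (hn i)
    set T := 2 * √3 * y i ^ 2 * Real.exp (Real.pi / (6 * y i)) with hT
    set J := ∫ u in (-1 : ℝ)..1, majorFactor (y i) u *
        Complex.exp (-(Real.pi / (12 * y i) * u ^ 2 / (1 - u * Complex.I)))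
    have hT0 : 0 < T := by positivity
    have hTc : (T : ℂ) ≠ 0 := by exact_mod_cast hT0.ne'
    have hconst : y i * (√(y i) * Real.exp (Real.pi / (6 * y i))) =
        T * (√(Real.pi / (12 * y i)) / √Real.pi) := by
      have h12 : √(12 * y i) = 2 * √3 * √(y i) := by
        rw [Real.sqrt_mul (by norm_num), show (12 : ℝ) = 2 ^ 2 * 3 by norm_num,
          Real.sqrt_mul (by norm_num), Real.sqrt_sq (by norm_num)]
      have hsq := Real.sq_sqrt hi.le
      have h0 := Real.sqrt_pos.mpr hi
      rw [Real.sqrt_div Real.pi_pos.le, h12, hT]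
      have := Real.sqrt_pos.mpr Real.pi_pos
      field_simp
      linear_combination hsq
    have hconst' : (y i : ℂ) * (√(y i) * Real.exp (Real.pi / (6 * y i))) =
        T * (√(Real.pi / (12 * y i)) / √Real.pi) := by exact_mod_cast hconst
    have heq : (partCount (n i) : ℂ) / T - √(Real.pi / (12 * y i)) * J / √Real.pi =
        (partCount (n i) - y i * (√(y i) * Real.exp (Real.pi / (6 * y i)) * J)) / T := by
      rw [← mul_assoc, hconst']
      field_simp
    rw [heq, norm_div, Complex.norm_real, Real.norm_of_nonneg hT0.le, div_le_iff₀ hT0]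
    refine h.trans (le_of_eq ?_)
    rw [Function.comp_apply, hT, sub_eq_add_neg, Real.exp_add, div_div 1 100]
    field_simp
  have hc := hdiff.add hmain
  simp only [Function.comp_apply, sub_add_cancel, zero_add] at hc
  have := (Complex.continuous_re.tendsto _).comp hc
  simp only [Complex.one_re] at this
  refine this.congr fun i => ?_
  rw [Function.comp_apply]
  norm_cast

theorem one_le_partCount (n : ℕ) : 1 ≤ partCount n :=
  Fintype.card_pos

/-- As `N → ∞`, `ν(N) = p(N+1) - 1` is asymptotically equivalent to
`exp (π √(2(N+1)/3)) / (4 √3 (N+1))`: the ratio of the two tends to `1`. -/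
theorem nu_asymptotic :
    Tendsto (fun N : ℕ => (nu N : ℝ) /
        (Real.exp (Real.pi * Real.sqrt (2 * (N + 1) / 3)) / (4 * Real.sqrt 3 * (N + 1))))
      atTop (nhds 1) := by
  let y : ℕ → ℝ := fun N => (√(24 * (N + 1)))⁻¹
  have hpos : ∀ N, 0 < y N := fun N => by positivity
  have hn : ∀ N : ℕ, 24 * ((N + 1 : ℕ) : ℝ) * y N ^ 2 = 1 := fun N => by
    have : (24 * (N + 1) : ℝ) ≠ 0 := by positivity
    simp only [y]
    rw [inv_pow, Real.sq_sqrt (by positivity)]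
    push_cast
    field_simp
  have hy : Tendsto y atTop (nhdsWithin 0 (Set.Ioi 0)) := by
    refine tendsto_nhdsWithin_iff.mpr ⟨?_, .of_forall hpos⟩
    exact tendsto_inv_atTop_zero.comp (Real.tendsto_sqrt_atTop.comp
      (Tendsto.const_mul_atTop (by norm_num)
        (tendsto_natCast_atTop_atTop.atTop_add tendsto_const_nhds)))
  have h1 := tendsto_partCount_div hy hn
  have h2 := ((tendsto_exp_neg_div_div_sq (c := Real.pi / 6) (by positivity)).div_const
    (2 * √3)).comp hy
  have h := h1.sub h2
  rw [zero_div, sub_zero] at h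
  refine h.congr fun N => ?_
  have hN := hn N
  push_cast at hN
  have hyN := hpos N
  have hsqrt : √(2 * (N + 1) / 3) = 1 / (6 * y N) := by
    rw [Real.sqrt_eq_iff_mul_self_eq_of_pos (by positivity)]
    field_simp
    linear_combination -3 * hN
  have hden : 4 * √3 * ((N : ℝ) + 1) = (2 * √3 * y N ^ 2)⁻¹ := by
    have := Real.sq_sqrt (show (0 : ℝ) ≤ 3 by norm_num)
    refine eq_inv_of_mul_eq_one_left ?_
    linear_combination hN + 8 * (N + 1) * y N ^ 2 * this
  rw [nu, Nat.cast_sub (one_le_partCount _), hsqrt, hden, Function.comp_apply, Nat.cast_one,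
    Real.exp_neg, div_div Real.pi, mul_one_div]
  field_simp
end

section
/- Let N ≥ 1, let 1 ≤ r ≤ N, and let π be a partition of r into exactly M parts in which, for each l ≥ 1, exactly n_l parts equal l (so M = Σ_l n_l and r = Σ_l l·n_l). Then the number of binary sequences of length N with exactly r successes whose multiset of success-run lengths equals π is W(π) = (M! / ∏_l n_l!) · C(N − r + 1, M), where C(·,·) is the binomial coefficient (equal to 0 when M > N − r + 1). -/
/-- The number of successes of `ξ`: the number of indices mapped to success (`true`). -/
def successCount {N : ℕ} (ξ : Fin N → Bool) : ℕ :=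
  (Finset.univ.filter fun i => ξ i = true).card

namespace Multiset

variable {α : Type*} [DecidableEq α]

theorem mem_toFinset_lists {s : Multiset α} {l : List α} :
    l ∈ s.lists.toFinset ↔ (l : Multiset α) = s := by
  rw [mem_toFinset, mem_lists_iff, eq_comm, quot_mk_to_coe]

theorem card_toFinset_lists_of_ne_zero {s : Multiset α} (hs : s ≠ 0) :
    s.lists.toFinset.card = ∑ a ∈ s.toFinset, (s.erase a).lists.toFinset.card := by
  have h : s.lists.toFinset =
      s.toFinset.biUnion fun a => (s.erase a).lists.toFinset.image (List.cons a) := by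
    ext l
    simp only [Finset.mem_biUnion, Finset.mem_image, mem_toFinset_lists]
    constructor
    · rintro rfl
      cases l with
      | nil => exact absurd rfl hs
      | cons a l => exact ⟨a, by simp, l, by simp, rfl⟩
    · rintro ⟨a, ha, l, hl, rfl⟩
      rw [← cons_coe, hl, cons_erase (mem_toFinset.1 ha)]
  rw [h, Finset.card_biUnion]
  · exact Finset.sum_congr rfl fun a _ =>
      Finset.card_image_of_injective _ List.cons_injective
  · intro a _ b _ hab
    rw [Function.onFun, Finset.disjoint_left]
    intro l hl hl'
    obtain ⟨x, -, rfl⟩ := Finset.mem_image.1 hl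
    obtain ⟨y, -, hy⟩ := Finset.mem_image.1 hl'
    exact hab (List.cons.inj hy).1.symm

theorem prod_factorial_count_eq_mul_erase {s : Multiset α} {a : α} (ha : a ∈ s) {T : Finset α}
    (haT : a ∈ T) :
    ∏ b ∈ T, (s.count b).factorial =
      s.count a * ∏ b ∈ T, ((s.erase a).count b).factorial := by
  rw [← Finset.mul_prod_erase T _ haT, ← Finset.mul_prod_erase T _ haT, ← mul_assoc,
    count_erase_self, Nat.mul_factorial_pred (count_pos.2 ha).ne']
  congr 1
  refine Finset.prod_congr rfl fun b hb => ?_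
  rw [count_erase_of_ne (Finset.ne_of_mem_erase hb)]

theorem card_toFinset_lists_mul_prod_factorial_count (T : Finset α) (s : Multiset α)
    (hs : ∀ a ∈ s, a ∈ T) :
    s.lists.toFinset.card * ∏ a ∈ T, (s.count a).factorial = (card s).factorial := by
  induction h : card s generalizing s with
  | zero =>
    obtain rfl := card_eq_zero.1 h
    have : (0 : Multiset α).lists.toFinset = {[]} := by
      ext l
      rw [mem_toFinset_lists, coe_eq_zero, Finset.mem_singleton]
    simp [this]
  | succ n ih =>
    have hs0 : s ≠ 0 := by
      rintro rfl
      simp at h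
    rw [card_toFinset_lists_of_ne_zero hs0, Finset.sum_mul, Nat.factorial_succ]
    calc _ = ∑ a ∈ s.toFinset, s.count a * n.factorial := by
          refine Finset.sum_congr rfl fun a ha => ?_
          have ha' := mem_toFinset.1 ha
          rw [prod_factorial_count_eq_mul_erase ha' (hs a ha'), mul_left_comm,
            ih (s.erase a) (fun b hb => hs b (mem_of_mem_erase hb))
              (by rw [card_erase_of_mem ha', h]; rfl)]
      _ = _ := by rw [← Finset.sum_mul, toFinset_sum_count_eq, h]

theorem filter_ne_zero_eq_iff {s p : Multiset ℕ} (hp : 0 ∉ p) :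
    s.filter (· ≠ 0) = p ↔ card p ≤ card s ∧ s = p + replicate (card s - card p) 0 := by
  constructor
  · rintro rfl
    refine ⟨card_le_card (filter_le _ _), ?_⟩
    have h := filter_add_not (· ≠ 0) s
    have h0 : s.filter (fun a => ¬ a ≠ 0) = replicate (s.count 0) 0 := by
      simpa using filter_eq' s 0
    rw [h0] at h
    have hc := congrArg card h
    rw [card_add, card_replicate] at hc
    rw [← hc, Nat.add_sub_cancel_left, h]
  · rintro ⟨-, h⟩
    rw [h, filter_add, filter_eq_self.2 fun a ha => ne_of_mem_of_not_mem ha hp,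
      filter_eq_nil.2, add_zero]
    intro a ha
    simp [eq_of_mem_replicate ha]

end Multiset

/-- The lengths, in order and possibly zero, of the blocks of `true`s separated by the `false`s. -/
def blockLengths (l : List Bool) : List ℕ :=
  (l.splitOn false).map List.length

theorem blockLengths_nil : blockLengths [] = [0] := by
  simp [blockLengths]

theorem blockLengths_cons_false (l : List Bool) :
    blockLengths (false :: l) = 0 :: blockLengths l := by
  simp [blockLengths, List.splitOn_cons_eq_if_modifyHead]

theorem blockLengths_cons_true (l : List Bool) :
    blockLengths (true :: l) = (blockLengths l).modifyHead (· + 1) := by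
  rw [blockLengths, blockLengths, List.splitOn_cons_eq_if_modifyHead]
  cases l.splitOn false <;> simp

theorem blockLengths_ne_nil (l : List Bool) : blockLengths l ≠ [] := by
  simp [blockLengths]

theorem length_blockLengths (l : List Bool) : (blockLengths l).length = l.count false + 1 := by
  induction l with
  | nil => simp [blockLengths_nil]
  | cons b l ih => cases b <;> simp [blockLengths_cons_false, blockLengths_cons_true, ih]

theorem sum_blockLengths (l : List Bool) : (blockLengths l).sum = l.count true := by
  induction l with
  | nil => simp [blockLengths_nil]
  | cons b l ih =>
    cases b
    · simp [blockLengths_cons_false, ih]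
    · rw [blockLengths_cons_true, List.count_cons_self, ← ih]
      obtain ⟨a, m, h⟩ := List.exists_cons_of_ne_nil (blockLengths_ne_nil l)
      simp [h]
      omega

theorem notMem_of_mem_splitOn {α : Type*} [DecidableEq α] {a : α} {l x : List α}
    (hx : x ∈ l.splitOn a) : a ∉ x := by
  induction l generalizing x with
  | nil => simp_all
  | cons b l ih =>
    rw [List.splitOn_cons_eq_if_modifyHead] at hx
    obtain ⟨y, m, h⟩ := List.exists_cons_of_ne_nil (List.splitOn_ne_nil a l)
    split_ifs at hx <;> simp_all <;> grind

theorem blockLengths_injective : Function.Injective blockLengths := by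
  refine Function.LeftInverse.injective
    (g := fun m => [false].intercalate (m.map (List.replicate · true))) fun l => ?_
  have h (x) (hx : x ∈ l.splitOn false) : List.replicate x.length true = x :=
    (List.eq_replicate_iff.2 ⟨rfl, fun b hb =>
      Bool.eq_true_of_not_eq_false fun hbf => notMem_of_mem_splitOn hx (hbf ▸ hb)⟩).symm
  simp only [blockLengths, List.map_map]
  rw [List.map_congr_left (g := id) (by simpa using h), List.map_id, List.intercalate_splitOn]

theorem exists_blockLengths_eq {m : List ℕ} (hm : m ≠ []) : ∃ l, blockLengths l = m := by
  refine ⟨[false].intercalate (m.map (List.replicate · true)), ?_⟩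
  rw [blockLengths, List.splitOn_intercalate false _ (by simpa using hm), List.map_map]
  · simp [Function.comp_def]
  · simp

theorem count_true_ofFn {N : ℕ} (ξ : Fin N → Bool) :
    (List.ofFn ξ).count true = successCount ξ := by
  rw [successCount, Finset.card_def, Finset.filter_val, Fin.univ_def, Multiset.filter_coe,
    Multiset.coe_card, List.ofFn_eq_map, List.count, List.countP_map, List.countP_eq_length_filter]
  congr 2

theorem runType_eq_filter_blockLengths {N : ℕ} (ξ : Fin N → Bool) :
    runType ξ = (blockLengths (List.ofFn ξ) : Multiset ℕ).filter (· ≠ 0) := by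
  rfl

theorem successCount_and_runType_iff {N r : ℕ} (hrN : r ≤ N) (π : Nat.Partition r)
    (ξ : Fin N → Bool) :
    (successCount ξ = r ∧ runType ξ = π.parts) ↔
      Multiset.card π.parts ≤ N - r + 1 ∧ (blockLengths (List.ofFn ξ) : Multiset ℕ) =
        π.parts + Multiset.replicate (N - r + 1 - Multiset.card π.parts) 0 := by
  have h0 : 0 ∉ π.parts := fun h => (π.parts_pos h).ne' rfl
  have hN : (List.ofFn ξ).count true + (List.ofFn ξ).count false = N := by
    simp
  have hlen := length_blockLengths (List.ofFn ξ)
  have hsum := sum_blockLengths (List.ofFn ξ)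
  rw [runType_eq_filter_blockLengths, Multiset.filter_ne_zero_eq_iff h0, ← count_true_ofFn,
    Multiset.coe_card]
  constructor
  · rintro ⟨hr, h⟩
    rwa [show (blockLengths (List.ofFn ξ)).length = N - r + 1 by omega] at h
  · rintro ⟨hle, h⟩
    have hr : (List.ofFn ξ).count true = r := by
      rw [← hsum, ← Multiset.sum_coe, h]
      simp [π.parts_sum]
    refine ⟨hr, ?_⟩
    rw [show (blockLengths (List.ofFn ξ)).length = N - r + 1 by omega]
    exact ⟨hle, h⟩

theorem card_filter_blockLengths_eq {N : ℕ} (s : Multiset ℕ)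
    (hs : Multiset.card s + s.sum = N + 1) (hs0 : s ≠ 0) :
    (Finset.univ.filter fun ξ : Fin N → Bool =>
      (blockLengths (List.ofFn ξ) : Multiset ℕ) = s).card = s.lists.toFinset.card := by
  refine Finset.card_bij (fun ξ _ => blockLengths (List.ofFn ξ)) ?_ ?_ ?_
  · intro ξ hξ
    exact Multiset.mem_toFinset_lists.2 (Finset.mem_filter.1 hξ).2
  · intro ξ _ η _ h
    exact List.ofFn_injective (blockLengths_injective h)
  · intro m hm
    rw [Multiset.mem_toFinset_lists] at hm
    subst hm
    obtain ⟨l, rfl⟩ := exists_blockLengths_eq (m := m) (by rintro rfl; exact hs0 rfl)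
    rw [Multiset.coe_card, Multiset.sum_coe, length_blockLengths, sum_blockLengths] at hs
    have hl := List.count_true_add_count_false l
    obtain rfl : l.length = N := by omega
    exact ⟨l.get, by simp, by simp⟩

/-- Let `N ≥ 1`, `1 ≤ r ≤ N`, and let `π` be a partition of `r` into exactly `M` parts, with
`n_l = π.parts.count l` parts equal to `l`. Then the number of binary sequences of length
`N` with exactly `r` successes whose multiset of success-run lengths equals `π` is
`W(π) = (M! / ∏_l n_l!) * C(N - r + 1, M)` (the binomial coefficient being `0` when
`M > N - r + 1`). -/
theorem card_seq_with_runType (N r M : ℕ) (hN : 1 ≤ N) (hr1 : 1 ≤ r) (hrN : r ≤ N)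
    (π : Nat.Partition r) (hπ : Multiset.card π.parts = M) :
    ((Finset.univ.filter (fun ξ : Fin N → Bool =>
          successCount ξ = r ∧ runType ξ = π.parts)).card : ℝ)
      = (Nat.factorial M : ℝ)
          / (∏ l ∈ Finset.Icc 1 r, (Nat.factorial (π.parts.count l) : ℝ))
          * (Nat.choose (N - r + 1) M : ℝ) := by
  simp only [successCount_and_runType_iff hrN, hπ]
  by_cases hM : M ≤ N - r + 1
  swap
  · simp [hM, Nat.choose_eq_zero_of_lt (not_le.1 hM)]
  simp only [hM, true_and]
  obtain ⟨d, hd⟩ := Nat.exists_eq_add_of_le hM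
  rw [hd, Nat.add_sub_cancel_left]
  set s := π.parts + Multiset.replicate d 0 with hs
  have hcard : Multiset.card s = M + d := by simp [hs, hπ]
  have hsum : s.sum = r := by simp [hs, π.parts_sum]
  rw [card_filter_blockLengths_eq s (by omega) (by rintro h; simp [h] at hsum; omega)]
  have h0 : 0 ∉ π.parts := fun h => (π.parts_pos h).ne' rfl
  have key := Multiset.card_toFinset_lists_mul_prod_factorial_count (insert 0 (Finset.Icc 1 r)) s
    (by
      intro a ha
      have := Multiset.le_sum_of_mem ha
      simp only [Finset.mem_insert, Finset.mem_Icc]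
      omega)
  have hprod : ∏ l ∈ Finset.Icc 1 r, (s.count l).factorial =
      ∏ l ∈ Finset.Icc 1 r, (π.parts.count l).factorial := by
    refine Finset.prod_congr rfl fun l hl => ?_
    have : 0 ≠ l := by have := (Finset.mem_Icc.1 hl).1; omega
    simp [hs, Multiset.count_replicate, this]
  have hzero : s.count 0 = d := by simp [hs, Multiset.count_eq_zero_of_notMem h0]
  rw [Finset.prod_insert (by simp), hprod, hzero, hcard] at key
  have hchoose := Nat.choose_symm_add (a := M) (b := d) ▸
    Nat.add_choose_mul_factorial_mul_factorial M d
  have hP : (∏ l ∈ Finset.Icc 1 r, ((π.parts.count l).factorial : ℝ)) ≠ 0 :=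
    Finset.prod_ne_zero_iff.2 fun l _ => by positivity
  rw [div_mul_eq_mul_div, eq_div_iff hP]
  refine mul_right_cancel₀ (b := (d.factorial : ℝ)) (by positivity) ?_
  have := key.trans hchoose.symm
  push_cast [← @Nat.cast_inj ℝ] at this
  linear_combination this
end
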